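/- Monotone descent of one full TransCLIP-ZS Block Majorize–Minimize iteration. Let N, K, d ≥ 1, let λ > 0, let W be a real N×N positive semi-definite matrix (symmetric with x^⊤Wx ≥ 0 for all x ∈ ℝ^N), let f_i ∈ ℝ^d for i ∈ {1,…,N}, and let ŷ_i ∈ Δ_K have positive entries for each i. For μ ∈ (ℝ^d)^K and σ ∈ (0,∞)^d define ℓ_{i,k}(μ,σ) := −(1/2) Σ_{m=1}^d [ log σ_m + (f_{i,m} − μ_{k,m})²/σ_m ], and define the zero-shot objective on (Δ_K)^N × (ℝ^d)^K × (0,∞)^d by L(z, μ, σ) := Σ_{i=1}^N [ −Σ_k z_{i,k} ℓ_{i,k}(μ,σ) + Σ_k z_{i,k} log z_{i,k} − λ Σ_k z_{i,k} log ŷ_{i,k} ] − (1/2) Σ_{i,j} W_{ij} Σ_k z_{i,k} z_{j,k} (with 0·log 0 = 0). Let (z⁰, μ⁰, σ⁰) be given with z⁰ ∈ (Δ_K)^N and σ⁰ ∈ (0,∞)^d, and perform one iteration of the three block updates: (z-step) z¹_i := softmax over k of ( λ log ŷ_{i,k} + ℓ_{i,k}(μ⁰,σ⁰) + Σ_j W_{ij}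 z⁰_{j,k} ); (μ-step) μ¹_k := ( Σ_i z¹_{i,k} f_i ) / ( Σ_i z¹_{i,k} ) (the denominator is positive since every z¹_{i,k} > 0); (σ-step) σ¹_m := (1/N) Σ_i Σ_k z¹_{i,k} (f_{i,m} − μ¹_{k,m})², assumed positive for every m. Then L(z¹, μ⁰, σ⁰) ≤ L(z⁰, μ⁰, σ⁰), L(z¹, μ¹, σ⁰) ≤ L(z¹, μ⁰, σ⁰), and L(z¹, μ¹, σ¹) ≤ L(z¹, μ¹, σ⁰); in particular L(z¹, μ¹, σ¹) ≤ L(z⁰, μ⁰, σ⁰), so the objective does not increase over a full iteration. -/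

import Mathlib

open Matrix

/-- The softmax minimizes entropy minus a linear functional over the simplex. -/
lemma softmax_entropy_le {ι : Type*} [Fintype ι] (a z p : ι → ℝ)
    (hz : z ∈ stdSimplex ℝ ι) (hp : ∀ k, p k = Real.exp (a k) / ∑ j, Real.exp (a j)) :
    ∑ k, (p k * Real.log (p k) - p k * a k) ≤ ∑ k, (z k * Real.log (z k) - z k * a k) := by
  obtain ⟨hz0, hzs⟩ := hz
  have hne : Nonempty ι := by
    by_contra h
    rw [not_nonempty_iff] at h
    simp at hzs
  have hS : 0 < ∑ j, Real.exp (a j) :=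
    Finset.sum_pos (fun j _ => Real.exp_pos _) Finset.univ_nonempty
  set S := ∑ j, Real.exp (a j) with hSdef
  have hppos : ∀ k, 0 < p k := fun k => by rw [hp]; exact div_pos (Real.exp_pos _) hS
  have hps : ∑ k, p k = 1 := by
    simp_rw [hp]
    rw [← Finset.sum_div, ← hSdef, div_self hS.ne']
  have hlog : ∀ k, Real.log (p k) = a k - Real.log S := fun k => by
    rw [hp, Real.log_div (Real.exp_pos _).ne' hS.ne', Real.log_exp]
  have hl : ∑ k, (p k * Real.log (p k) - p k * a k) = -Real.log S := by
    calc _ = ∑ k, p k * (-Real.log S) :=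
          Finset.sum_congr rfl fun k _ => by rw [hlog]; ring
      _ = _ := by rw [← Finset.sum_mul, hps, one_mul]
  have hr : ∑ k, (z k - p k - z k * Real.log S)
      ≤ ∑ k, (z k * Real.log (z k) - z k * a k) := by
    refine Finset.sum_le_sum fun k _ => ?_
    have ha : a k = Real.log (p k) + Real.log S := by rw [hlog]; ring
    rw [ha]
    rcases (hz0 k).eq_or_lt with h | h
    · rw [← h]; simp [(hppos k).le]
    · have h1 := Real.log_le_sub_one_of_pos (div_pos (hppos k) h)
      rw [Real.log_div (hppos k).ne' h.ne'] at h1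
      have h2 := mul_le_mul_of_nonneg_left h1 h.le
      have h3 : z k * (p k / z k - 1) = p k - z k := by field_simp
      rw [h3] at h2
      linarith
  rw [Finset.sum_sub_distrib, Finset.sum_sub_distrib, ← Finset.sum_mul, hzs, hps] at hr
  linarith

/-- Tangent-plane bound for the convex quadratic form of a positive semi-definite matrix. -/
lemma dotProduct_mulVec_sub_half_le {ι : Type*} [Fintype ι] (W : Matrix ι ι ℝ)
    (hWs : W.IsSymm) (hW : ∀ x : ι → ℝ, 0 ≤ x ⬝ᵥ (W *ᵥ x)) (x y : ι → ℝ) :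
    y ⬝ᵥ (W *ᵥ x) - 1 / 2 * (y ⬝ᵥ (W *ᵥ y)) ≤ 1 / 2 * (x ⬝ᵥ (W *ᵥ x)) := by
  have h := hW (y - x)
  have hs : x ⬝ᵥ (W *ᵥ y) = y ⬝ᵥ (W *ᵥ x) := by
    rw [dotProduct_mulVec, ← mulVec_transpose, hWs.eq, dotProduct_comm]
  rw [mulVec_sub, sub_dotProduct, dotProduct_sub, dotProduct_sub, hs] at h
  linarith

/-- The weighted mean minimizes the weighted sum of squared deviations. -/
lemma sum_mul_sq_sub_weightedMean_le {ι : Type*} [Fintype ι] (w g : ι → ℝ)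
    (hw : 0 < ∑ i, w i) (c : ℝ) :
    ∑ i, w i * (g i - (∑ j, w j * g j) / ∑ j, w j) ^ 2 ≤ ∑ i, w i * (g i - c) ^ 2 := by
  set S := ∑ i, w i with hS
  set A := ∑ j, w j * g j with hA
  have hexp : ∀ t : ℝ, ∑ i, w i * (g i - t) ^ 2
      = ∑ i, w i * g i ^ 2 - 2 * t * A + t ^ 2 * S := fun t => by
    rw [hS, hA, Finset.mul_sum, Finset.mul_sum, ← Finset.sum_sub_distrib,
      ← Finset.sum_add_distrib]
    exact Finset.sum_congr rfl fun i _ => by ring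
  have hAS : A = A / S * S := by field_simp
  rw [hexp, hexp]
  generalize A / S = t at hAS ⊢
  rw [hAS]
  linarith [mul_nonneg hw.le (sq_nonneg (t - c))]

/-- The expected negative Gaussian log-likelihood, summed coordinate by coordinate. -/
lemma sum_neg_sum_mul_gaussian {ι κ δ : Type*} [Fintype ι] [Fintype κ] [Fintype δ]
    (z : ι → κ → ℝ) (hz : ∀ i, ∑ k, z i k = 1) (f : ι → δ → ℝ) (μ : κ → δ → ℝ) (σ : δ → ℝ) :
    ∑ i, -∑ k, z i k * (-(1 / 2) * ∑ m, (Real.log (σ m) + (f i m - μ k m) ^ 2 / σ m))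
      = 1 / 2 * ∑ m, (Fintype.card ι * Real.log (σ m)
          + (∑ k, ∑ i, z i k * (f i m - μ k m) ^ 2) / σ m) := by
  have h1 : ∀ m, Fintype.card ι * Real.log (σ m) = ∑ i, ∑ k, z i k * Real.log (σ m) :=
    fun m => by simp [← Finset.sum_mul, hz]
  calc _ = ∑ i, ∑ k, ∑ m, 1 / 2 *
        (z i k * Real.log (σ m) + z i k * (f i m - μ k m) ^ 2 / σ m) := by
        refine Finset.sum_congr rfl fun i _ => ?_
        rw [← Finset.sum_neg_distrib]
        refine Finset.sum_congr rfl fun k _ => ?_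
        rw [Finset.mul_sum, Finset.mul_sum, ← Finset.sum_neg_distrib]
        exact Finset.sum_congr rfl fun m _ => by ring
    _ = ∑ m, ∑ i, ∑ k, 1 / 2 *
        (z i k * Real.log (σ m) + z i k * (f i m - μ k m) ^ 2 / σ m) := by
        rw [Finset.sum_comm (s := (Finset.univ : Finset δ))]
        exact Finset.sum_congr rfl fun i _ => Finset.sum_comm
    _ = _ := by
        rw [Finset.mul_sum]
        refine Finset.sum_congr rfl fun m _ => ?_
        rw [h1, Finset.sum_comm (s := (Finset.univ : Finset κ)), Finset.sum_div,
          ← Finset.sum_add_distrib, Finset.mul_sum]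
        refine Finset.sum_congr rfl fun i _ => ?_
        rw [Finset.sum_div, ← Finset.sum_add_distrib, Finset.mul_sum]

/-- Monotone descent of one full TransCLIP-ZS Block Majorize–Minimize iteration:
the z-step (softmax update with majorized Laplacian term), the μ-step (weighted
means) and the σ-step (weighted variances) each do not increase the zero-shot
objective `L`, hence neither does the full iteration. -/
theorem transclip_zs_bmm_iteration_descent
    (N K d : ℕ) (hN : 1 ≤ N) (hK : 1 ≤ K) (hd : 1 ≤ d)
    (lam : ℝ) (hlam : 0 < lam)
    (W : Matrix (Fin N) (Fin N) ℝ) (hWs : W.IsSymm)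
    (hWpsd : ∀ x : Fin N → ℝ, 0 ≤ x ⬝ᵥ (W *ᵥ x))
    (f : Fin N → Fin d → ℝ)
    (yhat : Fin N → Fin K → ℝ)
    (hyhat : ∀ i, yhat i ∈ stdSimplex ℝ (Fin K)) (hypos : ∀ i k, 0 < yhat i k)
    (ℓ : Fin N → Fin K → (Fin K → Fin d → ℝ) → (Fin d → ℝ) → ℝ)
    (hℓ : ∀ i k μ σ, ℓ i k μ σ =
      -(1 / 2) * ∑ m, (Real.log (σ m) + (f i m - μ k m) ^ 2 / σ m))
    (L : (Fin N → Fin K → ℝ) → (Fin K → Fin d → ℝ) → (Fin d → ℝ) → ℝ)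
    (hL : ∀ z μ σ, L z μ σ =
      (∑ i, ((-∑ k, z i k * ℓ i k μ σ) + (∑ k, z i k * Real.log (z i k))
        - lam * ∑ k, z i k * Real.log (yhat i k)))
      - (1 / 2) * ∑ i, ∑ j, W i j * ∑ k, z i k * z j k)
    (z0 : Fin N → Fin K → ℝ) (hz0 : ∀ i, z0 i ∈ stdSimplex ℝ (Fin K))
    (μ0 : Fin K → Fin d → ℝ) (σ0 : Fin d → ℝ) (hσ0 : ∀ m, 0 < σ0 m)
    (z1 : Fin N → Fin K → ℝ)
    (hz1 : ∀ i k, z1 i k =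
      Real.exp (lam * Real.log (yhat i k) + ℓ i k μ0 σ0 + ∑ j, W i j * z0 j k)
        / ∑ k', Real.exp (lam * Real.log (yhat i k') + ℓ i k' μ0 σ0
            + ∑ j, W i j * z0 j k'))
    (μ1 : Fin K → Fin d → ℝ)
    (hμ1 : ∀ k m, μ1 k m = (∑ i, z1 i k * f i m) / ∑ i, z1 i k)
    (σ1 : Fin d → ℝ)
    (hσ1 : ∀ m, σ1 m = (1 / (N : ℝ)) * ∑ i, ∑ k, z1 i k * (f i m - μ1 k m) ^ 2)
    (hσ1pos : ∀ m, 0 < σ1 m) :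
    L z1 μ0 σ0 ≤ L z0 μ0 σ0 ∧
    L z1 μ1 σ0 ≤ L z1 μ0 σ0 ∧
    L z1 μ1 σ1 ≤ L z1 μ1 σ0 ∧
    L z1 μ1 σ1 ≤ L z0 μ0 σ0 := by
  have hN0 : Nonempty (Fin N) := ⟨⟨0, hN⟩⟩
  have hK0 : Nonempty (Fin K) := ⟨⟨0, hK⟩⟩
  have hz1pos : ∀ i k, 0 < z1 i k := fun i k => by
    rw [hz1]
    exact div_pos (Real.exp_pos _)
      (Finset.sum_pos (fun j _ => Real.exp_pos _) Finset.univ_nonempty)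
  have hz1sum : ∀ i, ∑ k, z1 i k = 1 := fun i => by
    simp_rw [hz1]
    rw [← Finset.sum_div, div_self]
    exact (Finset.sum_pos (fun j _ => Real.exp_pos _) Finset.univ_nonempty).ne'
  have hNpos : (0 : ℝ) < N := by exact_mod_cast hN
  have hquad : ∀ x y : Fin N → Fin K → ℝ, ∑ i, ∑ k, x i k * ∑ j, W i j * y j k
      = ∑ k, (fun i => x i k) ⬝ᵥ (W *ᵥ fun j => y j k) := fun x y => by
    rw [Finset.sum_comm]; rfl
  have hquad' : ∀ x : Fin N → Fin K → ℝ, ∑ i, ∑ j, W i j * ∑ k, x i k * x j k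
      = ∑ i, ∑ k, x i k * ∑ j, W i j * x j k := fun x => by
    refine Finset.sum_congr rfl fun i _ => ?_
    simp_rw [Finset.mul_sum]
    rw [Finset.sum_comm]
    exact Finset.sum_congr rfl fun k _ => Finset.sum_congr rfl fun j _ => by ring
  have hLz : ∀ z, L z μ0 σ0 = ∑ i, ∑ k, (z i k * Real.log (z i k) - z i k *
        (lam * Real.log (yhat i k) + ℓ i k μ0 σ0 + ∑ j, W i j * z0 j k))
      + (∑ k, (fun i => z i k) ⬝ᵥ (W *ᵥ fun j => z0 j k)
        - 1 / 2 * ∑ k, (fun i => z i k) ⬝ᵥ (W *ᵥ fun j => z j k)) := fun z => by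
    rw [hL, hquad', hquad, ← add_sub_assoc, ← hquad z z0, ← Finset.sum_add_distrib]
    congr 1
    refine Finset.sum_congr rfl fun i _ => ?_
    rw [← Finset.sum_neg_distrib, Finset.mul_sum, ← Finset.sum_add_distrib,
      ← Finset.sum_sub_distrib, ← Finset.sum_add_distrib]
    exact Finset.sum_congr rfl fun k _ => by ring
  have hLg : ∀ μ σ, L z1 μ σ = 1 / 2 * ∑ m, (N * Real.log (σ m)
          + (∑ k, ∑ i, z1 i k * (f i m - μ k m) ^ 2) / σ m)
      + (∑ i, ((∑ k, z1 i k * Real.log (z1 i k)) - lam * ∑ k, z1 i k * Real.log (yhat i k))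
      - (1 / 2) * ∑ i, ∑ j, W i j * ∑ k, z1 i k * z1 j k) := fun μ σ => by
    have h := sum_neg_sum_mul_gaussian z1 hz1sum f μ σ
    rw [Fintype.card_fin] at h
    rw [hL, ← h, ← add_sub_assoc, ← Finset.sum_add_distrib]
    simp_rw [hℓ, add_sub_assoc]
  have hstepz : L z1 μ0 σ0 ≤ L z0 μ0 σ0 := by
    rw [hLz, hLz]
    refine add_le_add (Finset.sum_le_sum fun i _ =>
      softmax_entropy_le _ _ _ (hz0 i) (hz1 i)) ?_
    have h := Finset.sum_le_sum fun k (_ : k ∈ Finset.univ) =>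
      dotProduct_mulVec_sub_half_le W hWs hWpsd (fun i => z0 i k) (fun i => z1 i k)
    rw [Finset.sum_sub_distrib, ← Finset.mul_sum, ← Finset.mul_sum] at h
    linarith
  have hstepμ : L z1 μ1 σ0 ≤ L z1 μ0 σ0 := by
    rw [hLg, hLg]
    gcongr 1 / 2 * ?_ + _
    refine Finset.sum_le_sum fun m _ => ?_
    gcongr _ + ?_ / _
    · exact (hσ0 m).le
    · refine Finset.sum_le_sum fun k _ => ?_
      rw [hμ1]
      exact sum_mul_sq_sub_weightedMean_le (fun i => z1 i k) (fun i => f i m)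
        (Finset.sum_pos (fun i _ => hz1pos i k) Finset.univ_nonempty) _
  have hstepσ : L z1 μ1 σ1 ≤ L z1 μ1 σ0 := by
    rw [hLg, hLg]
    gcongr 1 / 2 * ?_ + _
    refine Finset.sum_le_sum fun m _ => ?_
    have hV : ∑ k, ∑ i, z1 i k * (f i m - μ1 k m) ^ 2 = N * σ1 m := by
      rw [hσ1, Finset.sum_comm]; field_simp
    have h := Real.log_le_sub_one_of_pos (div_pos (hσ1pos m) (hσ0 m))
    rw [Real.log_div (hσ1pos m).ne' (hσ0 m).ne'] at h
    rw [hV, mul_div_assoc, mul_div_assoc, div_self (hσ1pos m).ne', ← mul_add, ← mul_add]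
    exact mul_le_mul_of_nonneg_left (by linarith) hNpos.le
  exact ⟨hstepz, hstepμ, hstepσ, hstepσ.trans (hstepμ.trans hstepz)⟩
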